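/- arXiv:2104.14930 — 4 statements merged into one kernel-verified Lean document; each statement's English description precedes it below -/
import Mathlib

section
/- Let G be a group, let p and q be integers with p ≥ 1 and q ≥ 1, and let R1, R2, R3 be elements of G. Set W = R2*R3. Assume that W commutes with R1, that W^p = R1^(p+q), and that R3 * R1⁻¹ * R2 = R1 * W⁻¹. Then R3 * W^(q−1) * R2 = W^(−q). -/
/-- Let `G` be a group, `p, q ≥ 1` integers, `R1, R2, R3 ∈ G`, `W = R2*R3`.
If `W` commutes with `R1`, `W^p = R1^(p+q)` and `R3 * R1⁻¹ * R2 = R1 * W⁻¹`,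
then `R3 * W^(q-1) * R2 = W^(-q)`. -/
theorem stmt_2 {G : Type*} [Group G] (p q : ℤ) (hp : 1 ≤ p) (hq : 1 ≤ q)
    (R1 R2 R3 : G)
    (hcomm : (R2 * R3) * R1 = R1 * (R2 * R3))
    (hpow : (R2 * R3) ^ p = R1 ^ (p + q))
    (hrel : R3 * R1⁻¹ * R2 = R1 * (R2 * R3)⁻¹) :
    R3 * (R2 * R3) ^ (q - 1) * R2 = (R2 * R3) ^ (-q) := by
  have hconj (x : G) : R3 * x * R2 = R3 * (x * (R2 * R3)) * R3⁻¹ := by group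
  rw [hconj] at hrel ⊢
  generalize R2 * R3 = W at *
  have hc : Commute R1 W := Commute.symm hcomm
  have hn := congrArg (· ^ (p + q)) hrel
  simp only [conj_zpow, hc.inv_left.mul_zpow, hc.inv_right.mul_zpow, inv_zpow', zpow_neg, ← hpow] at hn
  rw [← zpow_neg, ← zpow_add, ← zpow_neg, ← zpow_add] at hn
  rw [← zpow_add_one]
  convert hn using 4 <;> ring
end

section
/- Let G be a left-ordered group, let p and q be integers with p ≥ 1 and q ≥ 1, and let W1, W2, W3, W4, W5, R1, R2, R3 be elements of G satisfying: W1 = W2*W3, W2*W3 = W4*W5, W1^p = R1^(p+q), W2 = R2⁻¹*R1, W3 = R3⁻¹*R1, W4 = R2, W5 = R3, and W1*R1 = R1*W1. Then R2 and R3 have opposite signs: if 1 ≤ R2 then R3 ≤ 1, and if R2 ≤ 1 then 1 ≤ R3. -/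
theorem not_one_lt_of_coarse_relations {G : Type*} [Group G] [LinearOrder G] [MulLeftMono G]
    {m k : ℕ} (hm : m ≠ 0) {a b r : G}
    (hpow : (a * b) ^ m = r ^ (m + (k + 1)))
    (hrel : a * b = a⁻¹ * r * (b⁻¹ * r))
    (hcomm : a * b * r = r * (a * b)) (ha : 1 ≤ a) : ¬ 1 < b := by
  intro hb
  obtain ⟨t, ht⟩ : ∃ t, t = r⁻¹ * (a * b) := ⟨_, rfl⟩
  have hab : a * b = r * t := by rw [ht]; group
  have hrt : Commute r t := by
    have h : r * t * r = r * (r * t) := by rw [← hab, hcomm]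
    exact (mul_left_cancel (by rw [← mul_assoc, h] : r * (t * r) = r * (r * t))).symm
  have htp : t ^ m = r ^ (k + 1) := by
    rw [hab, hrt.mul_pow, pow_add] at hpow
    exact mul_left_cancel hpow
  have htb : a * (t * b) = r := by
    have h : t * r = a⁻¹ * r * (b⁻¹ * r) := by rw [← hrel, hab, hrt.eq]
    have h' : t = a⁻¹ * r * b⁻¹ := mul_right_cancel (by rw [h]; group : t * r = _ * r)
    rw [h']; group
  have hbt : b = t * b * t := by
    apply mul_left_cancel (a := a)
    rw [hab, ← mul_assoc, htb]
  have hab1 : 1 < a * b := one_lt_mul_of_le_of_lt' ha hb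
  have hr : 1 < r := by
    by_contra! h
    exact (one_lt_pow' hab1 hm).not_ge (hpow ▸ pow_le_one' h _)
  have ht1 : 1 < t := by
    by_contra! h
    exact (one_lt_pow' hr k.succ_ne_zero).not_ge (htp ▸ pow_le_one' h _)
  have hu : (t ^ m)⁻¹ * r ≤ 1 := by
    by_contra! h
    have hc : Commute ((t ^ m)⁻¹ * r) (t ^ m) :=
      (Commute.refl (t ^ m)).inv_left.mul_left (hrt.pow_right m)
    have h1 : ((t ^ m)⁻¹ * r) ^ (k + 1) * (t ^ m) ^ k = 1 := by
      apply mul_right_cancel (b := t ^ m)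
      rw [mul_assoc, ← pow_succ, ← hc.mul_pow, hc.eq, mul_inv_cancel_left, one_mul, htp]
    exact (one_lt_mul_of_lt_of_le' (one_lt_pow' h k.succ_ne_zero)
      (one_le_pow_of_one_le' (one_lt_pow' ht1 hm).le k)).ne' h1
  have hs : SemiconjBy b⁻¹ t⁻¹ t := by
    have h : t * b⁻¹ = b⁻¹ * t⁻¹ := by
      nth_rewrite 1 [hbt]; group
    exact h.symm
  have hv : t ^ (m + 1) * b⁻¹ < 1 := by
    rw [← (hs.pow_right (m + 1)).eq, inv_pow, ← mul_inv_rev, Left.inv_lt_one_iff]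
    exact one_lt_mul_of_le_of_lt' (one_lt_pow' ht1 m.succ_ne_zero).le hb
  have hfac : a = (t ^ m)⁻¹ * r * (t ^ (m + 1) * b⁻¹) := by
    apply mul_right_cancel (b := b)
    rw [hab, mul_assoc, mul_assoc, inv_mul_cancel_right, (hrt.pow_right (m + 1)).eq, pow_succ,
      mul_assoc, inv_mul_cancel_left, hrt.eq]
  exact ha.not_gt (hfac ▸ mul_lt_one_of_le_of_lt hu hv)

/-- Let `G` be a left-ordered group, `p, q ≥ 1` integers, and
`W1, W2, W3, W4, W5, R1, R2, R3 ∈ G` satisfying the coarse Brunner relations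
`W1 = W2*W3`, `W2*W3 = W4*W5`, `W1^p = R1^(p+q)`, `W2 = R2⁻¹*R1`, `W3 = R3⁻¹*R1`,
`W4 = R2`, `W5 = R3`, and `W1*R1 = R1*W1`.
Then `R2` and `R3` have opposite signs. -/
theorem stmt_3 {G : Type*} [Group G] [LinearOrder G]
    [CovariantClass G G (· * ·) (· ≤ ·)]
    (p q : ℤ) (hp : 1 ≤ p) (hq : 1 ≤ q)
    (W1 W2 W3 W4 W5 R1 R2 R3 : G)
    (h1 : W1 = W2 * W3) (h2 : W2 * W3 = W4 * W5)
    (h3 : W1 ^ p = R1 ^ (p + q))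
    (h4 : W2 = R2⁻¹ * R1) (h5 : W3 = R3⁻¹ * R1)
    (h6 : W4 = R2) (h7 : W5 = R3)
    (h8 : W1 * R1 = R1 * W1) :
    (1 ≤ R2 → R3 ≤ 1) ∧ (R2 ≤ 1 → 1 ≤ R3) := by
  subst h6 h7
  lift p to ℕ using by lia
  lift q to ℕ using by lia
  obtain ⟨k, rfl⟩ : ∃ k, q = k + 1 := ⟨q - 1, by lia⟩
  have hm : p ≠ 0 := by lia
  have hW : W1 = W4 * W5 := h1.trans h2
  have hpow : (W4 * W5) ^ p = R1 ^ (p + (k + 1)) := by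
    rw [← hW]; exact_mod_cast h3
  have hrel : W4 * W5 = W4⁻¹ * R1 * (W5⁻¹ * R1) := by rw [← h2, h4, h5]
  rw [hW] at h8
  refine ⟨fun h => not_lt.mp (not_one_lt_of_coarse_relations hm hpow hrel h8 h), fun h => ?_⟩
  exact not_lt.mp (not_one_lt_of_coarse_relations (G := Gᵒᵈ) hm hpow hrel h8 h)
end

section
/- Let G be a left-ordered group, let q ≥ 1 be an integer, and let R2, R3 be elements of G. Set W = R2*R3 and assume R3 * W^(q−1) * R2 = W^(−q). If 1 ≤ R2, then R3 ≤ 1. -/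
/-- Let `G` be a left-ordered group, `q ≥ 1` an integer, `R2, R3 ∈ G`, `W = R2*R3`.
If `R3 * W^(q-1) * R2 = W^(-q)` and `1 ≤ R2`, then `R3 ≤ 1`. -/
theorem stmt_4 {G : Type*} [Group G] [LinearOrder G]
    [CovariantClass G G (· * ·) (· ≤ ·)]
    (q : ℤ) (hq : 1 ≤ q) (R2 R3 : G)
    (hrel : R3 * (R2 * R3) ^ (q - 1) * R2 = (R2 * R3) ^ (-q))
    (hR2 : 1 ≤ R2) :
    R3 ≤ 1 := by
  by_contra! hR3
  obtain ⟨n, hn⟩ := Int.eq_ofNat_of_zero_le (sub_nonneg.mpr hq)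
  obtain rfl : q = n + 1 := by omega
  have hW : 1 ≤ R2 * R3 := one_le_mul hR2 hR3.le
  have hpos : 1 < R3 * ((R2 * R3) ^ n * (R2 * (R2 * R3) ^ (n + 1))) :=
    one_lt_mul_of_lt_of_le' hR3 (one_le_mul (one_le_pow_of_one_le' hW n)
      (one_le_mul hR2 (one_le_pow_of_one_le' hW (n + 1))))
  rw [hn, zpow_natCast, zpow_neg, eq_inv_iff_mul_eq_one] at hrel
  refine hpos.ne' ?_
  rw [← hrel, ← Nat.cast_succ, zpow_natCast]
  simp only [mul_assoc]
end

section
/- Let G be a left-ordered group, let k ≥ 1 be an integer, and let R1, R2, R3 be elements of G with R3 ≤ 1 ≤ R2. Assume the relations R2⁻¹*R1 = R2 * (R3⁻¹*R2)^k and R1⁻¹*R3 = R3⁻¹ * (R3⁻¹*R2)^k. Then R1 = R2 = R3 = 1. -/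
/-- Let `G` be a left-ordered group, `k ≥ 1` an integer, and `R1, R2, R3 ∈ G` with
`R3 ≤ 1 ≤ R2`. If `R2⁻¹*R1 = R2 * (R3⁻¹*R2)^k` and `R1⁻¹*R3 = R3⁻¹ * (R3⁻¹*R2)^k`,
then `R1 = R2 = R3 = 1`. -/
theorem stmt_7 {G : Type*} [Group G] [LinearOrder G]
    [CovariantClass G G (· * ·) (· ≤ ·)]
    (k : ℤ) (hk : 1 ≤ k) (R1 R2 R3 : G)
    (hR3 : R3 ≤ 1) (hR2 : 1 ≤ R2)
    (h1 : R2⁻¹ * R1 = R2 * (R3⁻¹ * R2) ^ k)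
    (h2 : R1⁻¹ * R3 = R3⁻¹ * (R3⁻¹ * R2) ^ k) :
    R1 = 1 ∧ R2 = 1 ∧ R3 = 1 := by
  have h3 : 1 ≤ R3⁻¹ := by simpa using mul_le_mul_right hR3 R3⁻¹
  have hE : 1 ≤ (R3⁻¹ * R2) ^ k := by
    lift k to ℕ using by lia
    rw [zpow_natCast]
    exact one_le_pow_of_one_le' (one_le_mul h3 hR2) k
  have h21 : R2 ≤ R1 := by
    have h : 1 ≤ R2⁻¹ * R1 := h1 ▸ one_le_mul hR2 hE
    simpa using mul_le_mul_right h R2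
  have h13 : R1 ≤ R3 := by
    have h : 1 ≤ R1⁻¹ * R3 := h2 ▸ one_le_mul h3 hE
    simpa using mul_le_mul_right h R1
  exact ⟨le_antisymm (h13.trans hR3) (hR2.trans h21),
    le_antisymm (h21.trans (h13.trans hR3)) hR2,
    le_antisymm hR3 (hR2.trans (h21.trans h13))⟩
end
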